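/- arXiv:math/0210340 — 2 statements merged into one kernel-verified Lean document; each statement's English description precedes it below -/
import Mathlib

section
/- For all integers l and k with 1 < l < k and gcd(l, k) = 1, there exists an integer r with 2 ≤ r ≤ k−1 such that ∏_{s=1}^{r} sin(π l s / k) < 0. -/
open Finset

/-- For coprime integers `1 < l < k` there is an integer `r` with
`2 ≤ r ≤ k - 1` such that `∏_{s=1}^{r} sin(π l s / k) < 0`. -/
theorem exists_negative_sine_product (l k : ℤ) (hl : 1 < l) (hlk : l < k)
    (hcop : Int.gcd l k = 1) :
    ∃ r : ℤ, 2 ≤ r ∧ r ≤ k - 1 ∧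
      ∏ s ∈ Finset.Icc (1 : ℤ) r, Real.sin (Real.pi * l * s / k) < 0 := by
  have hk : (0 : ℝ) < k := by exact_mod_cast (by lia : (0 : ℤ) < k)
  have hndvd : ¬ l ∣ k := fun h => by
    have := Int.gcd_eq_left (by lia : 0 ≤ l) h
    lia
  -- `k / l + 1` is the first index at which the angle exceeds `π`.
  obtain ⟨q, hq⟩ : ∃ q, q = k / l := ⟨_, rfl⟩
  have hlt : l * q < k :=
    lt_of_le_of_ne (hq ▸ Int.mul_ediv_self_le (by lia)) fun h => hndvd ⟨q, h.symm⟩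
  have hgt : k < l * (q + 1) := by
    have := Int.lt_mul_ediv_self_add (x := k) (by lia : 0 < l)
    rw [← hq] at this
    linarith
  have hq1 : 1 ≤ q := hq ▸ (Int.le_ediv_iff_mul_le (by lia)).2 (by lia)
  refine ⟨q + 1, by lia, by nlinarith, ?_⟩
  have hIcc : Icc 1 (q + 1) = insert (q + 1) (Icc 1 q) := by
    ext s
    simp only [mem_Icc, mem_insert]
    lia
  rw [hIcc, prod_insert (by simp)]
  refine mul_neg_of_neg_of_pos ?_ (prod_pos fun s hs => ?_)
  · have h₁ : (k : ℝ) < l * (q + 1 : ℤ) := by exact_mod_cast hgt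
    have h₂ : (l : ℝ) * (q + 1 : ℤ) < 2 * k := by
      exact_mod_cast (by linarith : l * (q + 1) < 2 * k)
    rw [← Real.sin_sub_two_pi]
    apply Real.sin_neg_of_neg_of_neg_pi_lt
    · rw [sub_neg, div_lt_iff₀ hk]
      nlinarith [Real.pi_pos]
    · rw [lt_sub_iff_add_lt, lt_div_iff₀ hk]
      nlinarith [Real.pi_pos]
  · obtain ⟨hs₁, hs₂⟩ := mem_Icc.1 hs
    have h₁ : (0 : ℝ) < l * s := by exact_mod_cast (by positivity : 0 < l * s)
    have h₂ : (l : ℝ) * s < k := by exact_mod_cast (by nlinarith : l * s < k)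
    apply Real.sin_pos_of_pos_of_lt_pi
    · rw [mul_assoc]
      positivity
    · rw [div_lt_iff₀ hk]
      nlinarith [Real.pi_pos]
end

section
/- Let l and k be coprime integers with 1 ≤ l < k. Then all of the numbers ν_r := (cos(πl/(2k)))^{−r} · ∏_{s=1}^{r} ( sin(πls/k)/sin(πl/k) ), for r = 0, 1, …, k−1, are strictly positive if and only if l = 1. (The ν_r are the squared norms of the Fock basis vectors |r, 0, …, 0⟩ of F_{l/k}(n|m) in the contravariant Hermitian form; hence the form on F_{l/k}(n|m) is positive definite precisely when q = e^{iπl/k} is a primitive root of unity, l = 1.) -/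
open Finset

theorem Finset.prod_int_Icc_one_succ_top (f : ℤ → ℝ) {r : ℤ} (hr : 0 ≤ r) :
    ∏ s ∈ Finset.Icc (1 : ℤ) (r + 1), f s = (∏ s ∈ Finset.Icc (1 : ℤ) r, f s) * f (r + 1) := by
  have h : Finset.Icc (1 : ℤ) (r + 1) = insert (r + 1) (Finset.Icc (1 : ℤ) r) := by
    ext x
    simp only [Finset.mem_Icc, Finset.mem_insert]
    omega
  rw [h, Finset.prod_insert (by simp), mul_comm]

theorem sin_pi_mul_div_pos {a k : ℝ} (ha : 0 < a) (hak : a < k) :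
    0 < Real.sin (Real.pi * a / k) := by
  have hk : 0 < k := ha.trans hak
  apply Real.sin_pos_of_pos_of_lt_pi
  · positivity
  · rw [div_lt_iff₀ hk]
    exact mul_lt_mul_of_pos_left hak Real.pi_pos

theorem sin_pi_mul_div_neg {a k : ℝ} (hk : 0 < k) (ha : k < a) (hak : a < 2 * k) :
    Real.sin (Real.pi * a / k) < 0 := by
  have h := sin_pi_mul_div_pos (a := a - k) (k := k) (by linarith) (by linarith)
  have e : Real.pi * (a - k) / k = Real.pi * a / k - Real.pi := by
    field_simp
  rw [e, Real.sin_sub_pi] at h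
  linarith

theorem exists_int_lt_mul_lt_two_mul {l k : ℤ} (hl : 2 ≤ l) (hlk : l < k) :
    ∃ r : ℤ, 0 ≤ r ∧ r + 1 ≤ k - 1 ∧ k < l * (r + 1) ∧ l * (r + 1) < 2 * k := by
  have h1 := Int.emod_add_mul_ediv k l
  have h2 := Int.emod_nonneg k (show l ≠ 0 by omega)
  have h3 := Int.emod_lt_of_pos k (show 0 < l by omega)
  have h4 : 0 ≤ k / l := Int.ediv_nonneg (by omega) (by omega)
  refine ⟨k / l, h4, ?_, by linarith, by linarith⟩
  have h5 : 2 * (k / l) ≤ l * (k / l) := mul_le_mul_of_nonneg_right hl h4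
  omega

/-- For coprime integers `1 ≤ l < k`, all the squared norms
`ν_r = (cos(πl/(2k)))^{-r} ∏_{s=1}^{r} sin(πls/k)/sin(πl/k)`, `r = 0,…,k-1`, are strictly
positive if and only if `l = 1`. -/
theorem all_norms_positive_iff_primitive (l k : ℤ) (hl : 1 ≤ l) (hlk : l < k)
    (hcop : Int.gcd l k = 1) :
    (∀ r : ℤ, 0 ≤ r → r ≤ k - 1 →
        0 < (Real.cos (Real.pi * l / (2 * k)) ^ r)⁻¹ *
          ∏ s ∈ Finset.Icc (1 : ℤ) r,
            Real.sin (Real.pi * l * s / k) / Real.sin (Real.pi * l / k)) ↔ l = 1 := by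
  have hk : (0 : ℝ) < k := by exact_mod_cast (by omega : 0 < k)
  have hl0 : (0 : ℝ) < l := by exact_mod_cast (by omega : 0 < l)
  have hlk' : (l : ℝ) < k := by exact_mod_cast hlk
  have hsin : 0 < Real.sin (Real.pi * l / k) := sin_pi_mul_div_pos hl0 hlk'
  have hcos : 0 < Real.cos (Real.pi * l / (2 * k)) := by
    apply Real.cos_pos_of_mem_Ioo
    constructor
    · have : 0 < Real.pi * l / (2 * k) := by positivity
      linarith [Real.pi_pos]
    · rw [div_lt_div_iff₀ (by positivity) two_pos]
      nlinarith [Real.pi_pos]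
  constructor
  · intro h
    by_contra hne
    obtain ⟨r, hr0, hrk, hlt, hlt2⟩ := exists_int_lt_mul_lt_two_mul (by omega : 2 ≤ l) hlk
    have hneg : Real.sin (Real.pi * l * (r + 1 : ℤ) / k) < 0 := by
      rw [mul_assoc]
      exact sin_pi_mul_div_neg hk (by exact_mod_cast hlt) (by exact_mod_cast hlt2)
    have hprev := (pos_iff_pos_of_mul_pos (h r hr0 (by omega))).1
      (inv_pos.2 (zpow_pos hcos r))
    have hnext := (pos_iff_pos_of_mul_pos (h (r + 1) (by omega) hrk)).1
      (inv_pos.2 (zpow_pos hcos (r + 1)))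
    rw [Finset.prod_int_Icc_one_succ_top _ hr0] at hnext
    exact hnext.not_gt (mul_neg_of_pos_of_neg hprev (div_neg_of_neg_of_pos hneg hsin))
  · rintro rfl r - hrk
    refine mul_pos (inv_pos.2 (zpow_pos hcos r)) (Finset.prod_pos fun s hs => div_pos ?_ hsin)
    obtain ⟨hs1, hsr⟩ := Finset.mem_Icc.1 hs
    rw [mul_assoc]
    apply sin_pi_mul_div_pos
    · exact_mod_cast (by omega : 0 < 1 * s)
    · exact_mod_cast (by omega : 1 * s < k)
end
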